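/- If 1 ≤ t ≤ r, ℱ is a (≤r)-family, and m ≥ 1, then l(𝒮_{ℱ,m}, t) ≥ m · l(𝒮_{ℱ,m}, t+1). -/

import Mathlib

open Finset

section Defs

variable {α : Type*} [DecidableEq α]

/-- `famStar F T` is ℱ(T) = {F ∈ ℱ : T ⊆ F}. -/
def famStar (F : Finset (Finset α)) (T : Finset α) : Finset (Finset α) :=
  F.filter (fun A => T ⊆ A)

/-- `lstar F t` is l(ℱ,t): the maximum of |ℱ(T)| over all t-element sets T. -/
noncomputable def lstar (F : Finset (Finset α)) (t : ℕ) : ℕ :=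
  sSup {n : ℕ | ∃ T : Finset α, T.card = t ∧ n = (famStar F T).card}

/-- c(r,s,t) = max{r·C(s,t), s·C(r,t)} + 1 if t ≤ min{r,s}, and 1 otherwise. -/
def cfun (r s t : ℕ) : ℕ :=
  if t ≤ min r s then max (r * Nat.choose s t) (s * Nat.choose r t) + 1 else 1

/-- The tuple (𝒜_1, …, 𝒜_k) is cross-t-intersecting. -/
def CrossTuple (t : ℕ) {k : ℕ} (A : Fin k → Finset (Finset α)) : Prop :=
  ∀ i j : Fin k, i ≠ j → ∀ a ∈ A i, ∀ b ∈ A j, t ≤ (a ∩ b).card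

/-- The cross-t-star property. -/
def CrossTStar (t : ℕ) {k : ℕ} (F : Fin k → Finset (Finset α)) : Prop :=
  ∀ A : Fin k → Finset (Finset α), CrossTuple t A → (∀ i, A i ⊆ F i) →
    ∏ i, (A i).card ≤ ∏ i, lstar (F i) t

/-- The strict cross-t-star property. -/
def StrictCrossTStar (t : ℕ) {k : ℕ} (F : Fin k → Finset (Finset α)) : Prop :=
  ∀ A : Fin k → Finset (Finset α), CrossTuple t A → (∀ i, A i ⊆ F i) →
    ∏ i, (A i).card ≤ ∏ i, lstar (F i) t ∧
      ((¬ ∃ T : Finset α, T.card = t ∧ ∀ i, A i = famStar (F i) T) →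
        ∏ i, (A i).card < ∏ i, lstar (F i) t)

/-- The strong cross-t-star property. -/
def StrongCrossTStar (t : ℕ) {k : ℕ} (F : Fin k → Finset (Finset α)) : Prop :=
  ∃ T : Finset α, T.card = t ∧
    ∀ A : Fin k → Finset (Finset α), CrossTuple t A → (∀ i, A i ⊆ F i) →
      ∏ i, (A i).card ≤ ∏ i, (famStar (F i) T).card

/-- The extrastrong cross-t-star property. -/
def ExtrastrongCrossTStar (t : ℕ) {k : ℕ} (F : Fin k → Finset (Finset α)) : Prop :=
  ∃ T : Finset α, T.card = t ∧
    ∀ A : Fin k → Finset (Finset α), CrossTuple t A → (∀ i, A i ⊆ F i) →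
      ∏ i, (A i).card ≤ ∏ i, (famStar (F i) T).card ∧
        (∏ i, (A i).card = ∏ i, (famStar (F i) T).card →
          ∃ T' : Finset α, T'.card = t ∧ ∀ i, A i = famStar (F i) T')

/-- 𝒮_{X,m}: the family of subsets of X × [m] that are graphs of functions
from X to [m]; 𝒮_{∅,m} = ∅. -/
def seqFam (X : Finset α) (m : ℕ) : Finset (Finset (α × ℕ)) :=
  (X ×ˢ Finset.Icc 1 m).powerset.filter
    (fun S => S.Nonempty ∧ S.image Prod.fst = X ∧ S.card = X.card)

/-- 𝒮_{ℱ,m} = ⋃_{F ∈ ℱ} 𝒮_{F,m}. -/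
def seqFamU (F : Finset (Finset α)) (m : ℕ) : Finset (Finset (α × ℕ)) :=
  F.biUnion (fun X => seqFam X m)

/-- 𝒮*_{X,m}: the family of subsets of X × [m] that are graphs of injective
functions from X to [m]; 𝒮*_{∅,m} = ∅. -/
def seqFamInj (X : Finset α) (m : ℕ) : Finset (Finset (α × ℕ)) :=
  (seqFam X m).filter (fun S => (S.image Prod.snd).card = S.card)

/-- 𝒮*_{ℱ,m} = ⋃_{F ∈ ℱ} 𝒮*_{F,m}. -/
def seqFamInjU (F : Finset (Finset α)) (m : ℕ) : Finset (Finset (α × ℕ)) :=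
  F.biUnion (fun X => seqFamInj X m)

end Defs

open Classical in
/-- ℳ_{n,r}: representations S_A of multisets A with members in [n] of total size r:
the r-element sets S of pairs (a,j) with a ∈ [n], 1 ≤ j, such that (a,j) ∈ S and
1 ≤ j' ≤ j imply (a,j') ∈ S. -/
noncomputable def multFam (n r : ℕ) : Finset (Finset (ℕ × ℕ)) :=
  (Finset.Icc 1 n ×ˢ Finset.Icc 1 r).powerset.filter
    (fun S => S.card = r ∧ ∀ p ∈ S, ∀ j ∈ Finset.Icc 1 p.2, (p.1, j) ∈ S)

/-- 𝒞_{n,r}: representations S_a = {(1,a_1),…,(r,a_r)} of compositions (a_1,…,a_r)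
of n of length r, i.e. graphs of functions from [r] to positive integers summing to n. -/
def compFam (n r : ℕ) : Finset (Finset (ℕ × ℕ)) :=
  (Finset.Icc 1 r ×ˢ Finset.Icc 1 n).powerset.filter
    (fun S => S.image Prod.fst = Finset.Icc 1 r ∧ S.card = r ∧ ∑ p ∈ S, p.2 = n)

/-- 𝖯_{n,r}: the family of partitions of [n] of length r, each partition viewed
as the set of its parts. -/
def partFam (n r : ℕ) : Finset (Finset (Finset ℕ)) :=
  (Finset.Icc 1 n).powerset.powerset.filter
    (fun P => P.card = r ∧ (∀ X ∈ P, X ≠ ∅) ∧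
      (∀ X ∈ P, ∀ Y ∈ P, X ≠ Y → X ∩ Y = ∅) ∧
      P.biUnion id = Finset.Icc 1 n)

/-- s_{n,r} = |𝖯_{n,r}|, the Stirling number of the second kind. -/
def stirling (n r : ℕ) : ℕ := (partFam n r).card

theorem card_famStar_le_lstar {α : Type*} [DecidableEq α] (F : Finset (Finset α))
    (T : Finset α) : (famStar F T).card ≤ lstar F T.card := by
  refine le_csSup ⟨F.card, ?_⟩ ⟨T, rfl, rfl⟩
  rintro n ⟨T', -, rfl⟩
  exact card_filter_le _ _

theorem exists_card_famStar_eq_lstar {α : Type*} [DecidableEq α] {F : Finset (Finset α)} {t : ℕ}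
    (h : lstar F t ≠ 0) : ∃ T : Finset α, T.card = t ∧ lstar F t = (famStar F T).card := by
  have hne : {n : ℕ | ∃ T : Finset α, T.card = t ∧ n = (famStar F T).card}.Nonempty := by
    by_contra hempty
    rw [Set.not_nonempty_iff_eq_empty] at hempty
    exact h (by rw [lstar, hempty, csSup_empty, bot_eq_zero])
  refine Nat.sSup_mem hne ⟨F.card, ?_⟩
  rintro n ⟨T', -, rfl⟩
  exact card_filter_le _ _

theorem mem_seqFamU_iff {α : Type*} [DecidableEq α] {F : Finset (Finset α)} {m : ℕ}
    {S : Finset (α × ℕ)} :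
    S ∈ seqFamU F m ↔ S.Nonempty ∧ Set.InjOn Prod.fst (S : Set (α × ℕ)) ∧
      S.image Prod.fst ∈ F ∧ ∀ q ∈ S, q.2 ∈ Finset.Icc 1 m := by
  simp only [seqFamU, seqFam, mem_biUnion, mem_filter, mem_powerset]
  constructor
  · rintro ⟨X, hX, hsub, hne, rfl, hcard⟩
    exact ⟨hne, card_image_iff.mp hcard.symm, hX, fun q hq => (mem_product.mp (hsub hq)).2⟩
  · rintro ⟨hne, hinj, hF, hm⟩
    exact ⟨_, hF, fun q hq => mem_product.mpr ⟨mem_image_of_mem _ hq, hm q hq⟩, hne, rfl,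
      (card_image_iff.mpr hinj).symm⟩

theorem insert_erase_mem_seqFamU {α : Type*} [DecidableEq α] {F : Finset (Finset α)} {m : ℕ}
    {S : Finset (α × ℕ)} (hS : S ∈ seqFamU F m) {p : α × ℕ} (hp : p ∈ S) {y : ℕ}
    (hy : y ∈ Finset.Icc 1 m) : insert (p.1, y) (S.erase p) ∈ seqFamU F m := by
  rw [mem_seqFamU_iff] at hS ⊢
  obtain ⟨-, hinj, hF, hm⟩ := hS
  refine ⟨insert_nonempty _ _, ?_, ?_, ?_⟩
  · have hinj' : ∀ a ∈ S, ∀ b ∈ S, a.1 = b.1 → a = b := fun a ha b hb h => hinj ha hb h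
    intro a ha b hb hab
    simp only [coe_insert, Set.mem_insert_iff, mem_coe, mem_erase] at ha hb
    rcases ha with rfl | ha <;> rcases hb with rfl | hb
    · rfl
    · exact absurd (hinj' _ hb.2 _ hp hab.symm) hb.1
    · exact absurd (hinj' _ ha.2 _ hp hab) ha.1
    · exact hinj' _ ha.2 _ hb.2 hab
  · rwa [image_insert, ← image_insert (f := Prod.fst) (a := p), insert_erase hp]
  · intro q hq
    rcases mem_insert.mp hq with rfl | hq
    · exact hy
    · exact hm q (mem_of_mem_erase hq)

theorem mul_card_famStar_seqFamU_le {α : Type*} [DecidableEq α] (F : Finset (Finset α)) (m : ℕ)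
    {T : Finset (α × ℕ)} {p : α × ℕ} (hp : p ∈ T) :
    m * (famStar (seqFamU F m) T).card ≤ (famStar (seqFamU F m) (T.erase p)).card := by
  have hcard : (Finset.Icc 1 m ×ˢ famStar (seqFamU F m) T).card =
      m * (famStar (seqFamU F m) T).card := by simp
  rw [← hcard]
  have hunique : ∀ S ∈ famStar (seqFamU F m) T, p ∈ S ∧ ∀ z, (p.1, z) ∉ S.erase p := by
    intro S hS
    obtain ⟨hS, hT⟩ := mem_filter.mp hS
    refine ⟨hT hp, fun z hz => ?_⟩
    exact (mem_erase.mp hz).1 ((mem_seqFamU_iff.mp hS).2.1 (mem_of_mem_erase hz) (hT hp) rfl)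
  refine card_le_card_of_injOn (fun q => insert (p.1, q.1) (q.2.erase p)) ?_ ?_
  · rintro ⟨y, S⟩ h
    obtain ⟨hy, hS⟩ := mem_product.mp h
    obtain ⟨hS, hT⟩ := mem_filter.mp hS
    exact mem_filter.mpr ⟨insert_erase_mem_seqFamU hS (hT hp) hy,
      (erase_subset_erase p hT).trans (subset_insert _ _)⟩
  · rintro ⟨y, S⟩ h ⟨z, R⟩ h' heq
    obtain ⟨hpS, hS⟩ := hunique S (mem_product.mp h).2
    obtain ⟨hpR, hR⟩ := hunique R (mem_product.mp h').2
    replace heq : insert (p.1, y) (S.erase p) = insert (p.1, z) (R.erase p) := heq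
    have hyz : y = z := by
      have hmem : (p.1, y) ∈ insert (p.1, z) (R.erase p) := heq ▸ mem_insert_self _ _
      rcases mem_insert.mp hmem with h | h
      · exact congrArg Prod.snd h
      · exact absurd h (hR y)
    subst hyz
    have herase : S.erase p = R.erase p := by
      rw [← erase_insert (hS y), heq, erase_insert (hR y)]
    rw [← insert_erase hpS, herase, insert_erase hpR]

/-- Lemma 4.3: l(𝒮_{ℱ,m},t) ≥ m · l(𝒮_{ℱ,m},t+1). -/
theorem stmt_9 {α : Type*} [DecidableEq α] (r t m : ℕ) (ht : 1 ≤ t) (htr : t ≤ r)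
    (hm : 1 ≤ m) (F : Finset (Finset α)) (hFr : ∀ X ∈ F, X.card ≤ r) :
    m * lstar (seqFamU F m) (t + 1) ≤ lstar (seqFamU F m) t := by
  by_cases h : lstar (seqFamU F m) (t + 1) = 0
  · simp [h]
  obtain ⟨T, hT, heq⟩ := exists_card_famStar_eq_lstar h
  obtain ⟨p, hp⟩ : T.Nonempty := card_pos.mp (by omega)
  have hcard : (T.erase p).card = t := by rw [card_erase_of_mem hp, hT, Nat.add_sub_cancel]
  rw [heq, ← hcard]
  exact (mul_card_famStar_seqFamU_le F m hp).trans (card_famStar_le_lstar _ _)
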